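/- Let μ be a singular cardinal and let ⟨κ_i : i < cf μ⟩ be an increasing sequence of regular cardinals cofinal in μ with κ₀ ≥ cf μ. If μ⁺ ↠_{Q^{<ω}}^{κ_i} κ_{i+1} holds for every i < cf μ, then the tree property holds at μ⁺. -/

import Mathlib

/- Magidor–Malitz quantifier machinery and the tree property -/

open FirstOrder Cardinal

universe u

namespace MMPaper

def QSat {L : FirstOrder.Language.{u, u}} {M : Type u} [L.Structure M] (n : ℕ)
    (φ : L.Formula (Fin n ⊕ ℕ)) (p : ℕ → M) : Prop :=
  ∃ A : Set M, #A = #M ∧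
    ∀ a : Fin n → M, (∀ i, a i ∈ A) → φ.Realize (Sum.elim a p)

def QElem {L : FirstOrder.Language.{u, u}} {M : Type u} [L.Structure M] (n : ℕ)
    (N : L.ElementarySubstructure M) : Prop :=
  ∀ (φ : L.Formula (Fin n ⊕ ℕ)) (p : ℕ → N),
    QSat n φ p ↔ QSat n φ (fun i => (p i : M))

def MMRef (lam mu eta : Cardinal.{u}) : Prop :=
  ∀ (L : FirstOrder.Language.{u, u}), L.card ≤ eta →
    ∀ (M : Type u) [L.Structure M], #M = lam →
      ∃ N : L.ElementarySubstructure M, (∀ n : ℕ, QElem n N) ∧ #N = mu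

/-- The height of a node in a tree: the order type of its set of predecessors. -/
noncomputable def nodeHeight {T : Type u} (lt : T → T → Prop)
    (wo : ∀ t : T, IsWellOrder {s // lt s t} (fun a b => lt a.1 b.1)) (t : T) :
    Ordinal.{u} :=
  @Ordinal.type {s // lt s t} (fun a b => lt a.1 b.1) (wo t)

/-- The tree property at `ν`: every tree of height `ν.ord` all of whose levels have
cardinality `< ν` has a cofinal branch (a chain meeting every level). -/
def TreeProperty (ν : Cardinal.{u}) : Prop :=
  ∀ (T : Type u) (lt : T → T → Prop),
    Transitive lt → (∀ t, ¬ lt t t) →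
    ∀ wo : ∀ t : T, IsWellOrder {s // lt s t} (fun a b => lt a.1 b.1),
      (∀ t, nodeHeight lt wo t < ν.ord) →
      (∀ α < ν.ord, ∃ t, nodeHeight lt wo t = α) →
      (∀ α < ν.ord, #{t | nodeHeight lt wo t = α} < ν) →
      ∃ B : Set T, (∀ s ∈ B, ∀ t ∈ B, s ≠ t → lt s t ∨ lt t s) ∧
        ∀ α < ν.ord, ∃ t ∈ B, nodeHeight lt wo t = α

/-- The language with one binary relation symbol for each element of `ι`. -/
def binaryLanguage (ι : Type u) : FirstOrder.Language.{u, u} where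
  Functions _ := PEmpty
  Relations n := {_i : ι // n = 2}

lemma card_binaryLanguage (ι : Type u) : (binaryLanguage ι).card ≤ #ι := by
  refine mk_le_of_injective (f := fun s => match s with
    | Sum.inl x => (x.2 : PEmpty).elim
    | Sum.inr x => x.2.1) ?_
  rintro (⟨_, ⟨⟩⟩ | ⟨m, i, rfl⟩) (⟨_, ⟨⟩⟩ | ⟨n, j, rfl⟩) h
  cases (h : i = j)
  rfl

/-- Reflection, contrapositively: if every subset of size `mu` has a subset of size `mu` which is
homogeneous for some relation of a family, then so does the whole structure. -/
lemma MMRef.exists_homogeneous {lam mu eta : Cardinal.{u}} (h : MMRef lam mu eta)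
    (hmu : mu ≠ 0) {ι X : Type u} (hι : #ι ≤ eta) (hX : #X = lam) (S : ι → X → X → Prop)
    (hS : ∀ N : Set X, #N = mu → ∃ i, ∃ A ⊆ N, #A = mu ∧ ∀ a ∈ A, ∀ b ∈ A, S i a b) :
    ∃ i, ∃ A : Set X, #A = lam ∧ ∀ a ∈ A, ∀ b ∈ A, S i a b := by
  let _ : (binaryLanguage ι).Structure X :=
    { funMap := fun f => (f : PEmpty).elim
      RelMap := fun R x => S R.1 (x (Fin.cast R.2.symm 0)) (x (Fin.cast R.2.symm 1)) }
  obtain ⟨N, hQ, hN⟩ := h (binaryLanguage ι) ((card_binaryLanguage ι).trans hι) X hX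
  obtain ⟨i, A, hAN, hA, hAS⟩ := hS (N : Set X) hN
  let R : (binaryLanguage ι).Relations 2 := ⟨i, rfl⟩
  let φ : (binaryLanguage ι).Formula (Fin 2 ⊕ ℕ) :=
    R.formula₂ (Language.Term.var (Sum.inl 0)) (Language.Term.var (Sum.inl 1))
  have hφ (M : Type u) [(binaryLanguage ι).Structure M] (a : Fin 2 → M) (p : ℕ → M) :
      φ.Realize (Sum.elim a p) ↔ Language.Structure.RelMap R ![a 0, a 1] :=
    Language.Formula.realize_rel₂
  obtain ⟨x⟩ : Nonempty N := by
    rw [← mk_ne_zero_iff, hN]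
    exact hmu
  obtain ⟨B, hB, hBS⟩ := (hQ 2 φ fun _ => x).1 ⟨Subtype.val ⁻¹' A, by
    rw [mk_preimage_of_injective_of_subset_range _ _ Subtype.val_injective
      (by simpa using hAN), hA, hN], fun a ha => (hφ N a _).2 (hAS _ (ha 0) _ (ha 1))⟩
  exact ⟨i, B, hB.trans hX, fun a ha b hb => (hφ X ![a, b] _).1
    (hBS ![a, b] fun k => by fin_cases k <;> assumption)⟩

section Trees

variable {T : Type u} {lt : T → T → Prop}
  {wo : ∀ t : T, IsWellOrder {s // lt s t} (fun a b => lt a.1 b.1)}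

lemma nodeHeight_eq_typein (htr : Transitive lt) {s t : T} (h : lt s t) :
    nodeHeight lt wo s =
      @Ordinal.typein {s // lt s t} (fun a b => lt a.1 b.1) (wo t) ⟨s, h⟩ := by
  have := wo t
  have := wo s
  rw [← Ordinal.type_subrel]
  refine RelIso.ordinalType_congr ⟨⟨fun x => ⟨⟨x.1, htr x.2 h⟩, x.2⟩, fun x => ⟨x.1.1, x.2⟩,
    fun _ => rfl, fun _ => rfl⟩, Iff.rfl⟩

lemma nodeHeight_lt (htr : Transitive lt) {s t : T} (h : lt s t) :
    nodeHeight lt wo s < nodeHeight lt wo t := by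
  rw [nodeHeight_eq_typein htr h]
  have := wo t
  exact Ordinal.typein_lt_type _ _

lemma exists_lt_nodeHeight_eq (htr : Transitive lt) {t : T} {α : Ordinal.{u}}
    (h : α < nodeHeight lt wo t) : ∃ s, lt s t ∧ nodeHeight lt wo s = α := by
  have := wo t
  obtain ⟨⟨s, hs⟩, hsα⟩ := Ordinal.typein_surj _ h
  exact ⟨s, hs, (nodeHeight_eq_typein htr hs).trans hsα⟩

/-- Comparability of nodes. -/
def Comp (lt : T → T → Prop) (s t : T) : Prop := s = t ∨ lt s t ∨ lt t s

lemma comp_of_lt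
    (wo : ∀ t : T, IsWellOrder {s // lt s t} (fun a b => lt a.1 b.1)) {s t r : T} (hs : lt s r) (ht : lt t r) : Comp lt s t := by
  have := wo r
  rcases trichotomous_of (fun a b : {s // lt s r} => lt a.1 b.1) ⟨s, hs⟩ ⟨t, ht⟩ with h | h | h
  · exact Or.inr (Or.inl h)
  · exact Or.inl (congrArg Subtype.val h)
  · exact Or.inr (Or.inr h)

end Trees

section ToType

variable {ν : Cardinal.{u}}

/-- The level of the tree indexed by an element of `ν.ord.ToType`. -/
noncomputable abbrev idx (x : ν.ord.ToType) : Ordinal.{u} :=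
  Ordinal.typein (α := ν.ord.ToType) (· < ·) x

/-- A small subset of a regular cardinal is strictly bounded. -/
lemma exists_bound (hν : ν.IsRegular) {A : Set ν.ord.ToType} (hA : #A < ν) :
    ∃ d, ∀ a ∈ A, a < d := by
  rw [← not_isCofinal_iff]
  intro h
  have := Order.cof_le h
  rw [Ordinal.cof_toType, hν.cof_ord] at this
  exact this.not_gt hA

/-- A subset of full cardinality is cofinal. -/
lemma exists_mem_ge {A : Set ν.ord.ToType} (hA : #A = ν) (d : ν.ord.ToType) :
    ∃ a ∈ A, d ≤ a := by
  by_contra! h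
  have h1 : #A ≤ #(Set.Iio d) := mk_le_mk_of_subset h
  have h2 : #(Set.Iio d) < ν := by simpa using mk_Iio_lt d
  exact (h1.trans_lt h2).ne hA

end ToType

/-- A map from a set of regular cardinality to a smaller type is constant on a subset of the same
cardinality. -/
lemma exists_fiber {X α : Type u} {κ : Cardinal.{u}} (hκ : κ.IsRegular) {N : Set X} (hN : #N = κ)
    (hα : #α < κ) (f : X → α) : ∃ a, ∃ A ⊆ N, #A = κ ∧ ∀ x ∈ A, f x = a := by
  obtain ⟨a, A, hAN, hA, hf⟩ := infinite_pigeonhole_set (fun x : N => f x) κ hN.ge hκ.aleph0_le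
    (by rwa [hκ.cof_ord])
  exact ⟨a, A, hAN, ((mk_le_mk_of_subset hAN).trans hN.le).antisymm hA, fun x hx => hf hx⟩

/-- Let `μ` be singular and `⟨κ i : i < cf μ⟩` an increasing sequence of
regular cardinals cofinal in `μ` with `κ 0 ≥ cf μ`.  If `μ⁺ ↠_{Q^{<ω}}^{κ i} κ (i+1)` for
every `i < cf μ`, then the tree property holds at `μ⁺`. -/
theorem tree_property_of_mm_reflection (μ : Cardinal.{u})
    (hμinf : ℵ₀ ≤ μ) (hμsing : μ.ord.cof < μ)
    (κ : Ordinal.{u} → Cardinal.{u})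
    (hreg : ∀ i < (μ.ord.cof).ord, (κ i).IsRegular)
    (hmono : ∀ i j : Ordinal.{u}, i < j → j < (μ.ord.cof).ord → κ i < κ j)
    (hlt : ∀ i < (μ.ord.cof).ord, κ i < μ)
    (hcof : ∀ c < μ, ∃ i < (μ.ord.cof).ord, c ≤ κ i)
    (h0 : μ.ord.cof ≤ κ 0)
    (href : ∀ i < (μ.ord.cof).ord, MMRef (Order.succ μ) (κ (i + 1)) (κ i)) :
    TreeProperty (Order.succ μ) := by
  intro T lt htr hirr wo hht hlev hcard
  have hν : (Order.succ μ).IsRegular := isRegular_succ hμinf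
  have hcofinf : ℵ₀ ≤ μ.ord.cof := (isRegular_cof (isSuccLimit_ord hμinf)).aleph0_le
  have hlim := isSuccLimit_ord hcofinf
  have hsucc : ∀ i < (μ.ord.cof).ord, i + 1 < (μ.ord.cof).ord := fun i hi => hlim.add_one_lt hi
  have hself : ∀ i < (μ.ord.cof).ord, κ i < κ (i + 1) := fun i hi =>
    hmono i (i + 1) (lt_add_one i) (hsucc i hi)
  -- codes for the nodes of each level
  have hcode : ∃ e : T → μ.ord.ToType, ∀ s t, nodeHeight lt wo s = nodeHeight lt wo t →
      e s = e t → s = t := by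
    have h : ∀ α : Ordinal.{u}, ∃ e : T → μ.ord.ToType, α < (Order.succ μ).ord →
        Set.InjOn e {t | nodeHeight lt wo t = α} := by
      intro α
      have : Nonempty μ.ord.ToType := by
        rw [← mk_ne_zero_iff]
        simpa using (aleph0_pos.trans_le hμinf).ne'
      by_cases hα : α < (Order.succ μ).ord
      · have h1 : #{t | nodeHeight lt wo t = α} ≤ #μ.ord.ToType := by
          simpa using Order.lt_succ_iff.1 (hcard α hα)
        obtain ⟨f⟩ := h1
        classical
        refine ⟨fun t => if h : nodeHeight lt wo t = α then f ⟨t, h⟩ else Classical.arbitrary _,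
          fun _ s hs t ht hst => ?_⟩
        have hs' : nodeHeight lt wo s = α := hs
        have ht' : nodeHeight lt wo t = α := ht
        simp only [hs', ht', dif_pos] at hst
        exact congrArg Subtype.val (f.injective hst)
      · exact ⟨Classical.arbitrary _, fun h => absurd h hα⟩
    choose e he using h
    refine ⟨fun t => e (nodeHeight lt wo t) t, fun s t hst h => ?_⟩
    simp only [hst] at h
    exact he _ (hht t) hst rfl h
  obtain ⟨e, he⟩ := hcode
  let K : (μ.ord.cof).ord.ToType → Set μ.ord.ToType := fun i => {c | idx c < (κ (idx i)).ord}
  have hidx : ∀ i : (μ.ord.cof).ord.ToType, idx i < (μ.ord.cof).ord := Ordinal.typein_lt_self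
  have hKcard : ∀ i, #(K i) ≤ κ (idx i) := by
    intro i
    have h1 : (κ (idx i)).ord < Ordinal.type (α := μ.ord.ToType) (· < ·) := by
      simpa using hlt _ (hidx i)
    obtain ⟨d, hd⟩ := Ordinal.typein_surj _ h1
    have h2 : K i ⊆ Set.Iio d := fun c hc => by
      have : idx c < idx d := by
        change idx c < Ordinal.typein _ d
        rw [hd]; exact hc
      exact (Ordinal.typein_lt_typein (· < ·)).1 this
    refine (mk_le_mk_of_subset h2).trans ?_
    have h3 : #(Set.Iio d) = (idx d).card := rfl
    rw [h3, show idx d = _ from hd, card_ord]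
  have hKcover : ∀ c, ∃ i, c ∈ K i := by
    intro c
    obtain ⟨j, hj, hcj⟩ := hcof (idx c).card (lt_ord.1 (Ordinal.typein_lt_self c))
    have h1 : j + 1 < Ordinal.type (α := (μ.ord.cof).ord.ToType) (· < ·) := by
      simpa using hsucc j hj
    obtain ⟨i, hi⟩ := Ordinal.typein_surj _ h1
    refine ⟨i, ?_⟩
    change idx c < (κ (Ordinal.typein _ i)).ord
    rw [hi, lt_ord]
    exact hcj.trans_lt (hself j hj)
  have hX : #((Order.succ μ).ord.ToType) = Order.succ μ := by simp
  -- a narrow subsystem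
  obtain ⟨i, I, hI, hIS⟩ : ∃ i : (μ.ord.cof).ord.ToType, ∃ I : Set (Order.succ μ).ord.ToType,
      #I = Order.succ μ ∧ ∀ a ∈ I, ∀ b ∈ I, ∃ s t, nodeHeight lt wo s = idx a ∧
        nodeHeight lt wo t = idx b ∧ e s ∈ K i ∧ e t ∈ K i ∧ Comp lt s t := by
    have hpos : 0 < (μ.ord.cof).ord := hlim.bot_lt
    have hne1 : κ (0 + 1) ≠ 0 := (hreg _ (hsucc 0 hpos)).ne_zero
    refine (href 0 hpos).exists_homogeneous hne1 (by simpa using h0) hX _ fun N hN => ?_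
    rw [zero_add] at hN ⊢
    have h01 : (0 : Ordinal.{u}) + 1 = 1 := zero_add 1
    have hone := hsucc 0 hpos
    rw [h01] at hone
    have hc1 : μ.ord.cof < κ 1 := h0.trans_lt (by simpa using hself 0 hpos)
    obtain ⟨d, hd⟩ := exists_bound hν (A := N)
      (hN.trans_lt ((hlt 1 hone).trans (Order.lt_succ μ)))
    obtain ⟨t, ht⟩ := hlev (idx d) (Ordinal.typein_lt_self d)
    have hp : ∀ a, ∃ s i, a ∈ N → lt s t ∧ nodeHeight lt wo s = idx a ∧ e s ∈ K i := by
      intro a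
      by_cases ha : a ∈ N
      · have h1 : idx a < nodeHeight lt wo t := by
          rw [ht]; exact (Ordinal.typein_lt_typein (· < ·)).2 (hd a ha)
        obtain ⟨s, hs, hsa⟩ := exists_lt_nodeHeight_eq htr h1
        obtain ⟨i, hi⟩ := hKcover (e s)
        exact ⟨s, i, fun _ => ⟨hs, hsa, hi⟩⟩
      · obtain ⟨i, -⟩ := hKcover (e t)
        exact ⟨t, i, fun h => absurd h ha⟩
    choose s i hsi using hp
    obtain ⟨j, A, hAN, hA, hj⟩ := exists_fiber (hreg 1 hone) hN (by simpa using hc1) i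
    refine ⟨j, A, hAN, hA, fun a ha b hb => ?_⟩
    obtain ⟨ha1, ha2, ha3⟩ := hsi a (hAN ha)
    obtain ⟨hb1, hb2, hb3⟩ := hsi b (hAN hb)
    rw [hj a ha] at ha3
    rw [hj b hb] at hb3
    exact ⟨s a, s b, ha2, hb2, ha3, hb3, comp_of_lt wo ha1 hb1⟩
  -- a single code on which the subsystem is coherent
  obtain ⟨c, J, hJ, hJS⟩ : ∃ c : K i, ∃ J : Set I, #J = Order.succ μ ∧ ∀ a ∈ J, ∀ b ∈ J,
      ∃ s t, nodeHeight lt wo s = idx a.1 ∧ nodeHeight lt wo t = idx b.1 ∧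
        e s = c ∧ e t = c ∧ Comp lt s t := by
    refine (href _ (hidx i)).exists_homogeneous (hreg _ (hsucc _ (hidx i))).ne_zero (hKcard i) hI _ fun N hN => ?_
    have hi := hsucc _ (hidx i)
    have hN' : #(Subtype.val '' N : Set (Order.succ μ).ord.ToType) < Order.succ μ := by
      rw [mk_image_eq Subtype.val_injective, hN]
      exact (hlt _ hi).trans (Order.lt_succ μ)
    obtain ⟨d₀, hd₀⟩ := exists_bound hν hN'
    obtain ⟨d, hdI, hdd⟩ := exists_mem_ge hI d₀
    have hp : ∀ a : I, ∃ s t, nodeHeight lt wo s = idx a.1 ∧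
        nodeHeight lt wo t = idx d ∧ e s ∈ K i ∧ e t ∈ K i ∧ Comp lt s t :=
      fun a => hIS a a.2 d hdI
    choose s t hs ht hsK htK hst using hp
    have hlt' : ∀ a ∈ N, lt (s a) (t a) := by
      intro a ha
      have h1 : nodeHeight lt wo (s a) < nodeHeight lt wo (t a) := by
        rw [hs, ht]
        exact (Ordinal.typein_lt_typein (· < ·)).2
          ((hd₀ a ⟨a, ha, rfl⟩).trans_le hdd)
      rcases hst a with h | h | h
      · exact absurd (congrArg (nodeHeight lt wo) h) h1.ne
      · exact h
      · exact absurd (nodeHeight_lt htr h) h1.not_gt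
    have hprod : #(K i × K i) < κ (idx i + 1) := by
      rw [← mul_def]
      exact mul_lt_of_lt (hreg _ hi).aleph0_le ((hKcard i).trans_lt (hself _ (hidx i)))
        ((hKcard i).trans_lt (hself _ (hidx i)))
    obtain ⟨p, A, hAN, hA, hAp⟩ := exists_fiber (hreg _ hi) hN hprod
      (fun a => (⟨e (s a), hsK a⟩, ⟨e (t a), htK a⟩))
    have hes : ∀ a ∈ A, e (s a) = p.1 := fun a ha =>
      congrArg (fun q => (q.1 : μ.ord.ToType)) (hAp a ha)
    have het : ∀ a ∈ A, e (t a) = p.2 := fun a ha =>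
      congrArg (fun q => (q.2 : μ.ord.ToType)) (hAp a ha)
    refine ⟨p.1, A, hAN, hA, fun a ha b hb => ⟨s a, s b, hs a, hs b, hes a ha, hes b hb, ?_⟩⟩
    have htt : t a = t b := he _ _ ((ht a).trans (ht b).symm) ((het a ha).trans (het b hb).symm)
    exact comp_of_lt wo (hlt' a (hAN ha)) (htt ▸ hlt' b (hAN hb))
  -- the downward closure of the coherent nodes is a branch
  have hcomp : ∀ a ∈ J, ∀ b ∈ J, ∀ s t, nodeHeight lt wo s = idx a.1 → e s = c →
      nodeHeight lt wo t = idx b.1 → e t = c → Comp lt s t := by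
    intro a ha b hb s t hs hsc ht htc
    obtain ⟨s', t', hs', ht', hsc', htc', h⟩ := hJS a ha b hb
    rwa [he s s' (hs.trans hs'.symm) (hsc.trans hsc'.symm),
      he t t' (ht.trans ht'.symm) (htc.trans htc'.symm)]
  refine ⟨{s | ∃ a ∈ J, ∃ t, nodeHeight lt wo t = idx a.1 ∧ e t = c ∧ lt s t}, ?_, ?_⟩
  · rintro s ⟨a, ha, t, hta, htc, hst⟩ s' ⟨a', ha', t', hta', htc', hst'⟩ hne
    have key : Comp lt s s' := by
      rcases hcomp a ha a' ha' t t' hta htc hta' htc' with rfl | h | h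
      · exact comp_of_lt wo hst hst'
      · exact comp_of_lt wo (htr hst h) hst'
      · exact comp_of_lt wo hst (htr hst' h)
    exact key.resolve_left hne
  · intro α hα
    have h1 : Order.succ α < Ordinal.type (α := (Order.succ μ).ord.ToType) (· < ·) := by
      simpa using (isSuccLimit_ord hν.aleph0_le).succ_lt hα
    obtain ⟨d, hd⟩ := Ordinal.typein_surj _ h1
    have hJ' : #(Subtype.val '' J : Set (Order.succ μ).ord.ToType) = Order.succ μ := by
      rw [mk_image_eq Subtype.val_injective, hJ]
    obtain ⟨_, ⟨a, ha, rfl⟩, hda⟩ := exists_mem_ge hJ' d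
    obtain ⟨t, -, hta, -, htc, -⟩ := hJS a ha a ha
    have h2 : α < nodeHeight lt wo t := by
      have : Order.succ α ≤ idx a.1 := by
        rw [← hd]
        exact (Ordinal.typein_le_typein (· < ·)).2 (not_lt.2 hda)
      rw [hta]
      exact Order.succ_le_iff.1 this
    obtain ⟨s, hs, hsα⟩ := exists_lt_nodeHeight_eq htr h2
    exact ⟨s, ⟨a, ha, t, hta, htc, hs⟩, hsα⟩

end MMPaper
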